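/- arXiv:2108.09390 — 2 statements merged into one kernel-verified Lean document; each statement's English description precedes it below -/
import Mathlib

section
/- Let L be an EDT0L language over a finite alphabet Σ such that every word in L contains precisely n occurrences of the letter # ∈ Σ, where n ≥ 0. Let Σ̄⁰ = {ā⁰ : a ∈ Σ}, …, Σ̄ⁿ = {āⁿ : a ∈ Σ} be pairwise disjoint copies of Σ, all disjoint from Σ, and let φⁱ : Σ* → (Σ̄ⁱ)* be the free monoid homomorphism defined by aφⁱ = āⁱ for all a ∈ Σ. Then the language M = {(w₀φ⁰) # (w₁φ¹) # ⋯ # (wₙφⁿ) : w₀ # w₁ # ⋯ # wₙ ∈ L, where each wᵢ contains no occurrence of #} is EDT0L. -/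
namespace Paper

/-- Apply a letterwise substitution (i.e. the endomorphism of the free monoid `C*`
determined by its action on letters) to a word over `C`. -/
def subApply {C : Type*} (f : C → List C) (w : List C) : List C := (w.map f).flatten

/-- An EDT0L system: a finite extended alphabet `C`, an identification of some letters of
`C` with terminal letters of the alphabet `α` (injectively, modelling `Σ ⊆ C`), a start
word over `C`, and a rational control: a regular language over a finite set of letterwise
substitutions (endomorphisms of `C*`), a word of endomorphisms acting by composition. -/
structure EDT0LSystem (α : Type*) where
  C : Type
  finC : Fintype C
  term : C → Option α
  term_inj : ∀ c c' a, term c = some a → term c' = some a → c = c'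
  start : List C
  ι : Type
  finι : Fintype ι
  tab : ι → C → List C
  control : Language ι
  control_reg : control.IsRegular

/-- The endomorphism of `C*` given by a word of basic endomorphisms, applied to `w`
(the word `φ₁φ₂⋯φₖ` acts as `φ₁∘φ₂∘⋯∘φₖ`, functions written on the right). -/
def EDT0LSystem.apply {α : Type*} (S : EDT0LSystem α) (φs : List S.ι) (w : List S.C) :
    List S.C :=
  φs.foldl (fun v i => subApply (S.tab i) v) w

/-- The language accepted by an EDT0L system: `{ωφ : φ ∈ R} ∩ Σ*`. -/
def EDT0LSystem.accepts {α : Type*} (S : EDT0LSystem α) : Language α :=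
  { w | ∃ φs ∈ S.control, (S.apply φs S.start).map S.term = w.map Option.some }

/-- A language is EDT0L if it is accepted by some EDT0L system. -/
def IsEDT0L {α : Type*} (L : Language α) : Prop := ∃ S : EDT0LSystem α, S.accepts = L

/-- Evaluate a word over the alphabet `Σ ∪ Σ⁻¹` (a letter is a generator index together
with a sign) in a group. -/
def evalWord {G : Type*} [Group G] {ι : Type*} (gen : ι → G) (w : List (ι × Bool)) : G :=
  (w.map fun l => if l.2 then gen l.1 else (gen l.1)⁻¹).prod

/-- The word length of `g` with respect to the generating set `gen`. -/
noncomputable def wordLength {G : Type*} [Group G] {ι : Type*} (gen : ι → G) (g : G) : ℕ :=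
  sInf {n | ∃ w : List (ι × Bool), evalWord gen w = g ∧ w.length = n}

/-- A normal form is quasigeodesic if `|η(g)| ≤ λ·|g| + λ` for some `λ > 0`. -/
def IsQuasigeodesicNF {G : Type*} [Group G] {ι : Type*} (gen : ι → G)
    (η : G → List (ι × Bool)) : Prop :=
  ∃ lam : ℝ, 0 < lam ∧ ∀ g : G, ((η g).length : ℝ) ≤ lam * (wordLength gen g) + lam

/-- A normal form is regular if its image is a regular language. -/
def IsRegularNF {G : Type*} [Group G] {ι : Type*} (η : G → List (ι × Bool)) : Prop :=
  Language.IsRegular (Set.range η : Language (ι × Bool))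

/-- A subset of a group is rational if it is the image of a regular language under the
evaluation map from the free monoid on a finite monoid generating set. -/
def IsRationalSubset {G : Type*} [Group G] (A : Set G) : Prop :=
  ∃ (ι : Type) (_ : Fintype ι) (gen : ι → G) (L : Language ι),
    Submonoid.closure (Set.range gen) = ⊤ ∧ L.IsRegular ∧
      A = (fun w : List ι => (w.map gen).prod) '' L

/-- A subset of a group is recognisable if its full preimage under the evaluation map
from the free monoid on a finite monoid generating set is a regular language. -/
def IsRecognisableSubset {G : Type*} [Group G] (A : Set G) : Prop :=
  ∃ (ι : Type) (_ : Fintype ι) (gen : ι → G),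
    Submonoid.closure (Set.range gen) = ⊤ ∧
      Language.IsRegular ({w : List ι | (w.map gen).prod ∈ A} : Language ι)

/-- The word `w₁ # w₂ # ⋯ # wₘ` over `β ⊕ {#}`. -/
def hashWord {β : Type*} {m : ℕ} (ws : Fin m → List β) : List (β ⊕ Unit) :=
  List.intercalate [Sum.inr ()] (List.ofFn fun i => (ws i).map Sum.inl)

/-- `g : Fin m → G` is a solution of the system `E ⊆ G ∗ F_X` of equations. -/
def SolvesSystem {G : Type*} [Group G] {m : ℕ}
    (E : Set (Monoid.Coprod G (FreeGroup (Fin m)))) (g : Fin m → G) : Prop :=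
  ∀ e ∈ E, Monoid.Coprod.lift (MonoidHom.id G) (FreeGroup.lift g) e = 1

/-- The solution language of a system of equations with constraints, w.r.t. a normal form. -/
def solutionLanguageC {G : Type*} [Group G] {ι : Type*} (η : G → List (ι × Bool)) {m : ℕ}
    (E : Set (Monoid.Coprod G (FreeGroup (Fin m)))) (Rc : Fin m → Set G) :
    Language ((ι × Bool) ⊕ Unit) :=
  { w | ∃ g : Fin m → G, SolvesSystem E g ∧ (∀ i, g i ∈ Rc i) ∧
      w = hashWord fun i => η (g i) }

/-- The solution language of a system of equations, w.r.t. a normal form. -/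
def solutionLanguage {G : Type*} [Group G] {ι : Type*} (η : G → List (ι × Bool)) {m : ℕ}
    (E : Set (Monoid.Coprod G (FreeGroup (Fin m)))) : Language ((ι × Bool) ⊕ Unit) :=
  solutionLanguageC η E fun _ => Set.univ

/-- Evaluate a twisted word (a word over `H ∪ (F_X × Ω)`) at the assignment `g` of the
variables: each letter `(u, ψ)` becomes `ψ(uφ)` where `φ` is the homomorphism `F_X → H`
determined by `g`, and the word is multiplied out in `H`. -/
def twistedEval {H : Type*} [Group H] {m : ℕ} (Ω : Subgroup (MulAut H)) (g : Fin m → H)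
    (w : List (H ⊕ (FreeGroup (Fin m) × Ω))) : H :=
  (w.map (Sum.elim id fun p => (p.2 : MulAut H) (FreeGroup.lift g p.1))).prod

/-- The solution language of a system of `Ω`-twisted equations with constraints. -/
def twistedSolutionLanguage {H : Type*} [Group H] {ι : Type*} (Ω : Subgroup (MulAut H))
    (η : H → List (ι × Bool)) {m : ℕ}
    (E : Set (List (H ⊕ (FreeGroup (Fin m) × Ω)))) (Rc : Fin m → Set H) :
    Language ((ι × Bool) ⊕ Unit) :=
  { w | ∃ g : Fin m → H, (∀ e ∈ E, twistedEval Ω g e = 1) ∧ (∀ i, g i ∈ Rc i) ∧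
      w = hashWord fun i => η (g i) }


/-- The output of a Mealy machine with transition function `f` and output function `o`,
started in state `q`. -/
def mealy {Q α β : Type*} (f : Q → α → Q) (o : Q → α → β) : Q → List α → List β
  | _, [] => []
  | q, a :: u => o q a :: mealy f o (f q a) u

lemma mealy_append {Q α β : Type*} (f : Q → α → Q) (o : Q → α → β) (q : Q) (u v : List α) :
    mealy f o q (u ++ v) = mealy f o q u ++ mealy f o (u.foldl f q) v := by
  induction u generalizing q with
  | nil => rfl
  | cons a u ih => simp [mealy, ih]

/-- The letter `c` of a word, annotated with the state in which it is read; the letter `none`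
is a fresh start symbol and the letters `some (Sum.inr b)` are outputs. -/
abbrev AnnotatedLetter (C Q β : Type) : Type := Option ((C × Q) ⊕ β)

/-- Annotate every letter of a word by the state in which it is read, where the letter `c`
acts on the states by `g c`. -/
def annotate {C Q β : Type} (g : C → Q → Q) : Q → List C → List (AnnotatedLetter C Q β) :=
  mealy (fun q c => g c q) (fun q c => some (Sum.inl (c, q)))

namespace EDT0LSystem

variable {α β Q : Type} (S : EDT0LSystem α) (f : Q → α → Q) (o : Q → α → β)

/-- The action on states of the terminal letters. -/
def termAction (c : S.C) (q : Q) : Q := (S.term c).elim q (f q)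

/-- The action on states of the images of letters under the `i`-th substitution. -/
def pullAction (i : S.ι) (g : S.C → Q → Q) (c : S.C) (q : Q) : Q :=
  (S.tab i c).foldl (fun q c => g c q) q

/-- The action on states of the images of letters under a word of substitutions. -/
def wordAction : List S.ι → S.C → Q → Q
  | [] => S.termAction f
  | i :: φs => S.pullAction i (wordAction φs)

/-- Substitutions of the system accepting the image under a Mealy machine: `none` writes the
output, `some (none, g)` expands the start symbol, and `some (some i, g)` simulates the
`i`-th substitution, given that the letters of the resulting word will act by `g`. -/
def mealyTab (q₀ : Q) :
    Option (Option S.ι × (S.C → Q → Q)) → AnnotatedLetter S.C Q β → List (AnnotatedLetter S.C Q β)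
  | none, some (Sum.inl (c, q)) =>
      [(S.term c).elim (some (Sum.inl (c, q))) fun a => some (Sum.inr (o q a))]
  | some (none, g), none => annotate g q₀ S.start
  | some (some i, g), some (Sum.inl (c, q)) => annotate g q (S.tab i c)
  | _, x => [x]

/-- The control word for the Mealy machine image, after the expansion of the start symbol. -/
def mealyWord : List S.ι → List (Option (Option S.ι × (S.C → Q → Q)))
  | [] => [none]
  | i :: φs => some (some i, S.wordAction f φs) :: mealyWord φs

open Classical in
/-- The automaton checking that the actions guessed in a control word are the correct ones. -/
noncomputable def mealyDFA {σ : Type} (A : DFA S.ι σ) :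
    DFA (Option (Option S.ι × (S.C → Q → Q))) (Unit ⊕ (σ × (S.C → Q → Q)) ⊕ Bool) where
  step
    | Sum.inl _, some (none, g) => Sum.inr (Sum.inl (A.start, g))
    | Sum.inr (Sum.inl (s, g)), some (some i, g') =>
        if g = S.pullAction i g' then Sum.inr (Sum.inl (A.step s i, g'))
        else Sum.inr (Sum.inr false)
    | Sum.inr (Sum.inl (s, g)), none =>
        Sum.inr (Sum.inr (decide (g = S.termAction f ∧ s ∈ A.accept)))
    | _, _ => Sum.inr (Sum.inr false)
  start := Sum.inl ()
  accept := {Sum.inr (Sum.inr true)}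

lemma mealyDFA_evalFrom_false {σ : Type} (A : DFA S.ι σ)
    (l : List (Option (Option S.ι × (S.C → Q → Q)))) :
    (S.mealyDFA f A).evalFrom (Sum.inr (Sum.inr false)) l = Sum.inr (Sum.inr false) := by
  induction l with
  | nil => rfl
  | cons x l ih => rw [DFA.evalFrom_cons]; exact ih

lemma mealyDFA_evalFrom_bool {σ : Type} (A : DFA S.ι σ) (b : Bool)
    (l : List (Option (Option S.ι × (S.C → Q → Q)))) :
    (S.mealyDFA f A).evalFrom (Sum.inr (Sum.inr b)) l = Sum.inr (Sum.inr true) ↔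
      b = true ∧ l = [] := by
  cases l with
  | nil => simp
  | cons x l =>
    have h : (S.mealyDFA f A).step (Sum.inr (Sum.inr b)) x = Sum.inr (Sum.inr false) := rfl
    simp [DFA.evalFrom_cons, h, mealyDFA_evalFrom_false]

open Classical in
lemma mealyDFA_evalFrom {σ : Type} (A : DFA S.ι σ) (s : σ) (g : S.C → Q → Q)
    (l : List (Option (Option S.ι × (S.C → Q → Q)))) :
    (S.mealyDFA f A).evalFrom (Sum.inr (Sum.inl (s, g))) l = Sum.inr (Sum.inr true) ↔
      ∃ φs, g = S.wordAction f φs ∧ l = S.mealyWord f φs ∧ A.evalFrom s φs ∈ A.accept := by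
  induction l generalizing s g with
  | nil =>
    simp only [DFA.evalFrom_nil, reduceCtorEq, Sum.inr.injEq, false_iff]
    rintro ⟨_ | ⟨i, φs⟩, -, h, -⟩ <;> simp [mealyWord] at h
  | cons x l ih =>
    rw [DFA.evalFrom_cons]
    rcases x with _ | ⟨_ | i, g'⟩
    · have h : (S.mealyDFA f A).step (Sum.inr (Sum.inl (s, g))) none =
        Sum.inr (Sum.inr (decide (g = S.termAction f ∧ s ∈ A.accept))) := by
          simp [mealyDFA]
      rw [h, mealyDFA_evalFrom_bool, decide_eq_true_iff]
      constructor
      · rintro ⟨⟨h₁, h₂⟩, rfl⟩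
        exact ⟨[], h₁, rfl, h₂⟩
      · rintro ⟨_ | ⟨i, φs⟩, h₁, h₂, h₃⟩
        · exact ⟨⟨h₁, h₃⟩, by simpa [mealyWord] using h₂⟩
        · simp [mealyWord] at h₂
    · have h : (S.mealyDFA f A).step (Sum.inr (Sum.inl (s, g))) (some (none, g')) =
        Sum.inr (Sum.inr false) := rfl
      rw [h, mealyDFA_evalFrom_bool]
      simp only [Bool.false_eq_true, false_and, false_iff]
      rintro ⟨_ | ⟨i, φs⟩, -, h, -⟩ <;> simp [mealyWord] at h
    · have h : (S.mealyDFA f A).step (Sum.inr (Sum.inl (s, g))) (some (some i, g')) =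
        if g = S.pullAction i g' then Sum.inr (Sum.inl (A.step s i, g'))
        else Sum.inr (Sum.inr false) := by
          simp [mealyDFA]
      rw [h]
      constructor
      · intro h'
        split_ifs at h' with hg
        · obtain ⟨φs, h₁, h₂, h₃⟩ := (ih _ _).1 h'
          exact ⟨i :: φs, by rw [hg, h₁]; rfl, by rw [h₁, h₂]; rfl, by simpa using h₃⟩
        · simp [mealyDFA_evalFrom_bool] at h'
      · rintro ⟨_ | ⟨j, φs⟩, h₁, h₂, h₃⟩
        · simp [mealyWord] at h₂
        · simp only [mealyWord, List.cons.injEq, Option.some.injEq, Prod.mk.injEq] at h₂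
          obtain ⟨⟨rfl, rfl⟩, rfl⟩ := h₂
          rw [wordAction] at h₁
          rw [if_pos h₁, ih]
          exact ⟨φs, rfl, rfl, by simpa using h₃⟩

lemma mem_mealyDFA_accepts {σ : Type} (A : DFA S.ι σ)
    (l : List (Option (Option S.ι × (S.C → Q → Q)))) :
    l ∈ (S.mealyDFA f A).accepts ↔
      ∃ φs ∈ A.accepts, l = some (none, S.wordAction f φs) :: S.mealyWord f φs := by
  have hacc : l ∈ (S.mealyDFA f A).accepts ↔
      (S.mealyDFA f A).evalFrom (Sum.inl ()) l = Sum.inr (Sum.inr true) := Iff.rfl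
  rw [hacc]
  have hdead (x) (h : (S.mealyDFA f A).step (Sum.inl ()) x = Sum.inr (Sum.inr false)) (l) :
      (S.mealyDFA f A).evalFrom (Sum.inl ()) (x :: l) ≠ Sum.inr (Sum.inr true) := by
    simp [DFA.evalFrom_cons, h, mealyDFA_evalFrom_bool]
  rcases l with _ | ⟨_ | ⟨_ | i, g⟩, l⟩
  · simp
  · simpa using hdead none rfl l
  · have h : (S.mealyDFA f A).step (Sum.inl ()) (some (none, g)) =
      Sum.inr (Sum.inl (A.start, g)) := rfl
    rw [DFA.evalFrom_cons, h, mealyDFA_evalFrom]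
    constructor
    · rintro ⟨φs, rfl, rfl, h₃⟩
      exact ⟨φs, h₃, rfl⟩
    · rintro ⟨φs, h₃, h₂⟩
      simp only [List.cons.injEq, Option.some.injEq, Prod.mk.injEq, true_and] at h₂
      exact ⟨φs, h₂.1, h₂.2, h₃⟩
  · simpa using hdead (some (some i, g)) rfl l

lemma subApply_mealyTab_step (q₀ q : Q) (i : S.ι) (g : S.C → Q → Q) (w : List S.C) :
    subApply (S.mealyTab o q₀ (some (some i, g))) (annotate (S.pullAction i g) q w) =
      annotate g q (subApply (S.tab i) w) := by
  induction w generalizing q with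
  | nil => rfl
  | cons c w ih =>
    have h := ih (S.pullAction i g c q)
    simp only [subApply, annotate, mealy, List.map_cons, List.flatten_cons,
      mealy_append] at h ⊢
    rw [h]
    rfl

lemma foldl_mealyWord (q₀ q : Q) (φs : List S.ι) (w : List S.C) :
    (S.mealyWord f φs).foldl (fun v i => subApply (S.mealyTab o q₀ i) v)
        (annotate (S.wordAction f φs) q w) =
      subApply (S.mealyTab o q₀ none) (annotate (S.termAction f) q (S.apply φs w)) := by
  induction φs generalizing w with
  | nil => rfl
  | cons i φs ih =>
    simp only [mealyWord, List.foldl_cons, wordAction, subApply_mealyTab_step, ih]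
    rfl

/-- The terminal letters of the system accepting the image under a Mealy machine. -/
def annotatedTerm {C : Type} : AnnotatedLetter C Q β → Option β
  | some (Sum.inr b) => some b
  | _ => none

lemma map_annotatedTerm_eq_iff (q₀ q : Q) (w : List S.C) (v : List β) :
    (subApply (S.mealyTab o q₀ none) (annotate (S.termAction f) q w)).map annotatedTerm =
        v.map some ↔
      ∃ u, w.map S.term = u.map some ∧ v = mealy f o q u := by
  induction w generalizing q v with
  | nil =>
    constructor
    · intro h
      refine ⟨[], rfl, ?_⟩
      simpa [subApply, annotate, mealy] using h.symm
    · rintro ⟨u, h, rfl⟩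
      obtain rfl : u = [] := by simpa using h.symm
      rfl
  | cons c w ih =>
    have hcons : subApply (S.mealyTab o q₀ none) (annotate (S.termAction f) q (c :: w)) =
        (S.term c).elim (some (Sum.inl (c, q))) (fun a => some (Sum.inr (o q a))) ::
          subApply (S.mealyTab o q₀ none)
            (annotate (S.termAction f) (S.termAction f c q) w) := rfl
    rw [hcons, List.map_cons, List.map_cons]
    rcases hc : S.term c with _ | a
    · constructor
      · intro h
        cases v <;> simp [annotatedTerm] at h
      · rintro ⟨_ | ⟨a, u⟩, h, -⟩ <;> simp at h
    · have hq : S.termAction f c q = f q a := by simp [termAction, hc]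
      rw [hq]
      constructor
      · intro h
        rcases v with _ | ⟨b, v⟩
        · simp at h
        · simp only [Option.elim_some, annotatedTerm, List.map_cons, List.cons.injEq,
            Option.some.injEq] at h
          obtain ⟨u, h₁, h₂⟩ := (ih _ _).1 h.2
          exact ⟨a :: u, by simp [h₁], by rw [← h.1, h₂]; rfl⟩
      · rintro ⟨_ | ⟨a', u⟩, h, rfl⟩
        · simp at h
        · simp only [List.map_cons, List.cons.injEq, Option.some.injEq] at h
          obtain ⟨rfl, h⟩ := h
          simpa [mealy, annotatedTerm] using (ih _ _).2 ⟨u, h, rfl⟩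

end EDT0LSystem

/-- The image of an EDT0L language under a Mealy machine is EDT0L. -/
theorem IsEDT0L.mealy_image {α β Q : Type} [Finite β] [Finite Q] {L : Language α}
    (hL : IsEDT0L L) (f : Q → α → Q) (o : Q → α → β) (q₀ : Q) :
    IsEDT0L (mealy f o q₀ '' L : Language β) := by
  classical
  obtain ⟨S, rfl⟩ := hL
  obtain ⟨σ, hσ, A, hA⟩ := S.control_reg
  have := S.finC
  have := S.finι
  have := Fintype.ofFinite Q
  have := Fintype.ofFinite β
  refine ⟨⟨AnnotatedLetter S.C Q β, inferInstance, EDT0LSystem.annotatedTerm, ?_, [none],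
    Option (Option S.ι × (S.C → Q → Q)), inferInstance, S.mealyTab o q₀,
    (S.mealyDFA f A).accepts, ⟨_, inferInstance, _, rfl⟩⟩, ?_⟩
  · rintro (_ | _ | b) (_ | _ | b') a h h' <;>
      simp_all [EDT0LSystem.annotatedTerm]
  · have hrun (φs : List S.ι) (v : List β) :
        ((some (none, S.wordAction f φs) :: S.mealyWord f φs).foldl
          (fun v i => subApply (S.mealyTab o q₀ i) v) [none]).map EDT0LSystem.annotatedTerm =
            v.map some ↔
          ∃ u, (S.apply φs S.start).map S.term = u.map some ∧ v = mealy f o q₀ u := by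
      have hstart : subApply (S.mealyTab o q₀ (some (none, S.wordAction f φs))) [none] =
          annotate (S.wordAction f φs) q₀ S.start := by
        simp [subApply, EDT0LSystem.mealyTab]
      rw [List.foldl_cons, hstart, S.foldl_mealyWord, S.map_annotatedTerm_eq_iff]
    ext v
    constructor
    · rintro ⟨l, hl, hv⟩
      obtain ⟨φs, hφ, rfl⟩ := (S.mem_mealyDFA_accepts f A l).1 hl
      obtain ⟨u, hu, rfl⟩ := (hrun φs v).1 hv
      exact ⟨u, ⟨φs, hA ▸ hφ, hu⟩, rfl⟩
    · rintro ⟨u, ⟨φs, hφ, hu⟩, rfl⟩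
      exact ⟨_, (S.mem_mealyDFA_accepts f A _).2 ⟨φs, hA ▸ hφ, rfl⟩,
        (hrun φs _).2 ⟨u, hu, rfl⟩⟩

lemma intercalate_ofFn_succ {α : Type*} (s : List α) (m : ℕ) (w : Fin (m + 2) → List α) :
    List.intercalate s (List.ofFn w) =
      w 0 ++ s ++ List.intercalate s (List.ofFn fun i : Fin (m + 1) => w i.succ) := by
  rw [List.ofFn_succ, List.ofFn_succ]
  simp [List.intercalate_cons_cons]

lemma exists_intercalate_ofFn_eq {α : Type*} [DecidableEq α] (a : α) (u : List α) :
    ∃ w : Fin (u.count a + 1) → List α, (∀ i, a ∉ w i) ∧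
      List.intercalate [a] (List.ofFn w) = u := by
  suffices ∀ m, u.count a = m → ∃ w : Fin (m + 1) → List α, (∀ i, a ∉ w i) ∧
      List.intercalate [a] (List.ofFn w) = u from this _ rfl
  induction u with
  | nil =>
    rintro m rfl
    exact ⟨fun _ => [], by simp, by simp⟩
  | cons b u ih =>
    intro m hm
    by_cases hb : b = a
    · subst hb
      obtain ⟨w, hw, hu⟩ := ih _ rfl
      obtain rfl : u.count b + 1 = m := by simpa using hm
      refine ⟨Fin.cons [] w, fun i => ?_, ?_⟩
      · cases i using Fin.cases <;> simp [hw]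
      · rw [intercalate_ofFn_succ]
        simpa [-List.ofFn_succ] using hu
    · obtain ⟨w, hw, hu⟩ := ih m (by simpa [hb] using hm)
      refine ⟨Fin.cons (b :: w 0) fun i => w i.succ, fun i => ?_, ?_⟩
      · cases i using Fin.cases <;> simp [hw, Ne.symm hb]
      · cases m with
        | zero => simpa using hu
        | succ m =>
          rw [intercalate_ofFn_succ] at hu ⊢
          simpa using hu

/-- The largest element of `Fin (n + 1)` that is at most `k`. -/
def clampFin (n k : ℕ) : Fin (n + 1) := ⟨min k n, by omega⟩

/-- Transition function of the Mealy machine counting the occurrences of `hash`. -/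
def countStep {α : Type*} [DecidableEq α] (hash : α) (n : ℕ) (q : Fin (n + 1)) (a : α) :
    Fin (n + 1) :=
  if a = hash then clampFin n (q + 1) else q

/-- Output function of the Mealy machine counting the occurrences of `hash`. -/
def countOut {α : Type*} [DecidableEq α] (hash : α) (n : ℕ) (q : Fin (n + 1)) (a : α) :
    (α × Fin (n + 1)) ⊕ Unit :=
  if a = hash then Sum.inr () else Sum.inl (a, q)

lemma foldl_countStep_of_notMem {α : Type*} [DecidableEq α] {hash : α} (n : ℕ)
    (q : Fin (n + 1)) {u : List α} (hu : hash ∉ u) : u.foldl (countStep hash n) q = q := by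
  induction u with
  | nil => rfl
  | cons a u ih =>
    simp only [List.mem_cons, not_or] at hu
    simp [countStep, Ne.symm hu.1, ih hu.2]

lemma mealy_count_of_notMem {α : Type*} [DecidableEq α] {hash : α} (n : ℕ)
    (q : Fin (n + 1)) {u : List α} (hu : hash ∉ u) :
    mealy (countStep hash n) (countOut hash n) q u = u.map fun a => Sum.inl (a, q) := by
  induction u with
  | nil => rfl
  | cons a u ih =>
    simp only [List.mem_cons, not_or] at hu
    simp [mealy, countStep, countOut, Ne.symm hu.1, ih hu.2]

lemma mealy_count_intercalate {α : Type*} [DecidableEq α] {hash : α} (n m k : ℕ)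
    (w : Fin (m + 1) → List α) (hw : ∀ i, hash ∉ w i) :
    mealy (countStep hash n) (countOut hash n) (clampFin n k)
        (List.intercalate [hash] (List.ofFn w)) =
      List.intercalate [Sum.inr ()]
        (List.ofFn fun i => (w i).map fun a => Sum.inl (a, clampFin n (k + i))) := by
  induction m generalizing k with
  | zero => simp [mealy_count_of_notMem n _ (hw 0)]
  | succ m ih =>
    have hstep : countStep hash n (clampFin n k) hash = clampFin n (k + 1) := by
      simp only [countStep, clampFin, if_true, Fin.mk.injEq]
      omega
    rw [intercalate_ofFn_succ, intercalate_ofFn_succ, List.append_assoc, mealy_append,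
      mealy_count_of_notMem n _ (hw 0), foldl_countStep_of_notMem n _ (hw 0),
      List.singleton_append, mealy, hstep, ih _ _ fun i => hw i.succ]
    simp [countOut, Nat.add_assoc, Nat.add_comm 1]

/-- If `L` is EDT0L over `Σ` and every word of `L` has exactly `n`
occurrences of `#`, then the language obtained from `L` by rewriting each word
`w₀ # w₁ # ⋯ # wₙ` (each `wᵢ` hash-free) so that the letters of `wᵢ` are replaced by
their copies in the `i`-th disjoint copy of `Σ` (modelled as `Σ × Fin (n+1)`) is EDT0L. -/
theorem edt0l_different_alphabets {α : Type} [Fintype α] [DecidableEq α]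
    (hash : α) (n : ℕ) (L : Language α) (hL : IsEDT0L L)
    (hcount : ∀ u ∈ L, u.count hash = n) :
    IsEDT0L ({ v : List ((α × Fin (n + 1)) ⊕ Unit) | ∃ w : Fin (n + 1) → List α,
        (∀ i, hash ∉ w i) ∧
        List.intercalate [hash] (List.ofFn w) ∈ L ∧
        v = List.intercalate [Sum.inr ()]
          (List.ofFn fun i => (w i).map fun a => Sum.inl (a, i)) } :
      Language ((α × Fin (n + 1)) ⊕ Unit)) := by
  have hclamp (i : Fin (n + 1)) : clampFin n (0 + i) = i := by
    ext
    simp only [clampFin]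
    omega
  have hmealy (w : Fin (n + 1) → List α) (hw : ∀ i, hash ∉ w i) :=
    mealy_count_intercalate n n 0 w hw
  simp only [hclamp] at hmealy
  refine (congrArg IsEDT0L (Set.ext fun v => ?_)).mpr
    (hL.mealy_image (countStep hash n) (countOut hash n) (clampFin n 0))
  constructor
  · rintro ⟨w, hw, hL, rfl⟩
    exact ⟨_, hL, hmealy w hw⟩
  · rintro ⟨u, hu, rfl⟩
    obtain ⟨w, hw, rfl⟩ : ∃ w : Fin (n + 1) → List α, (∀ i, hash ∉ w i) ∧
        List.intercalate [hash] (List.ofFn w) = u :=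
      hcount u hu ▸ exists_intercalate_ofFn_eq hash u
    exact ⟨w, hw, hu, hmealy w hw⟩

end Paper
end

section
/- Let G be a group with finite generating set Σ, let H be a finite index subgroup of G, let T be a right transversal of H in G containing 1, let Z be the Schreier generating set for H, and let η be a normal form for (G, Σ). If η is quasigeodesic with respect to Σ, then the Schreier normal form ζ for (H, Z) with respect to η is quasigeodesic with respect to Z. -/
namespace Paper

/-- The Schreier rewriting of a word: given a transversal-representative function `rep`
and a word `a₁⋯aₘ` over `Σ ∪ Σ⁻¹`, starting at the transversal element `t`, produce the
word `(t₀a₁(t₀a₁)̄⁻¹)(t₁a₂(t₁a₂)̄⁻¹)⋯` over the Schreier generators `Z ∪ Z⁻¹`; a Schreier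
letter is a formal symbol indexed by a pair `(t, x) ∈ T × Σ` together with a sign
(a positive letter `((t,x),true)` stands for `tx(t̄x̄)⁻¹`, and `((t',x),false)` for its
inverse, which arises when the letter read is `x⁻¹`). -/
def schreierWord {G : Type} [Group G] {ι : Type} (rep : G → G) (gen : ι → G) :
    G → List (ι × Bool) → List ((G × ι) × Bool)
  | _, [] => []
  | t, (x, b) :: rest =>
    let a : G := if b then gen x else (gen x)⁻¹
    let t' := rep (t * a)
    (if b then ((t, x), true) else ((t', x), false)) :: schreierWord rep gen t' rest

/-- The value in `G` of a formal Schreier letter: `((t,x),true) ↦ tx(t̄x̄)⁻¹` and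
`((t,x),false)` is its inverse. -/
def schreierEval {G : Type} [Group G] {ι : Type} (rep : G → G) (gen : ι → G)
    (l : (G × ι) × Bool) : G :=
  if l.2 then l.1.1 * gen l.1.2 * (rep (l.1.1 * gen l.1.2))⁻¹
  else (l.1.1 * gen l.1.2 * (rep (l.1.1 * gen l.1.2))⁻¹)⁻¹

/-- The word length of an element of `H` with respect to the Schreier generating set
`Z = {tx(t̄x̄)⁻¹ : t ∈ T, x ∈ Σ}` (letters indexed by pairs `(t,x)` with `t` in the
transversal `T = range rep`). -/
noncomputable def schreierLength {G : Type} [Group G] {ι : Type} (rep : G → G)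
    (gen : ι → G) (h : G) : ℕ :=
  sInf {n | ∃ w : List ((G × ι) × Bool), (∀ l ∈ w, l.1.1 ∈ Set.range rep) ∧
    (w.map (schreierEval rep gen)).prod = h ∧ w.length = n}

theorem evalWord_append {G : Type*} [Group G] {ι : Type*} (gen : ι → G)
    (v w : List (ι × Bool)) : evalWord gen (v ++ w) = evalWord gen v * evalWord gen w := by
  simp [evalWord]

theorem wordLength_evalWord_le {G : Type*} [Group G] {ι : Type*} (gen : ι → G)
    (w : List (ι × Bool)) : wordLength gen (evalWord gen w) ≤ w.length :=
  Nat.sInf_le ⟨w, rfl, rfl⟩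

/-- If each letter of a word over a second alphabet is represented by a word of length at most
`M` over `gen`, the product of the letters has word length at most `M` times their number. -/
theorem wordLength_prod_map_le {G : Type*} [Group G] {ι κ : Type*} (gen : ι → G)
    (f : κ → G) (η : G → List (ι × Bool)) (hη : ∀ g, evalWord gen (η g) = g) (M : ℕ)
    (w : List κ) (hw : ∀ l ∈ w, (η (f l)).length ≤ M) :
    wordLength gen (w.map f).prod ≤ M * w.length := by
  have heval : evalWord gen (w.flatMap fun l => η (f l)) = (w.map f).prod := by
    clear hw
    induction w with
    | nil => rfl
    | cons l w ih => simp [evalWord_append, hη, ih]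
  rw [← heval]
  refine (wordLength_evalWord_le gen _).trans ?_
  clear heval
  induction w with
  | nil => simp
  | cons l w ih =>
    have h₁ := hw l (by simp)
    have h₂ := ih fun l hl => hw l (by simp [hl])
    simp only [List.flatMap_cons, List.length_append, List.length_cons, mul_add, mul_one]
    omega

theorem length_schreierWord {G : Type} [Group G] {ι : Type} (rep : G → G) (gen : ι → G)
    (t : G) (w : List (ι × Bool)) : (schreierWord rep gen t w).length = w.length := by
  induction w generalizing t with
  | nil => rfl
  | cons a w ih => simp [schreierWord, ih]

theorem mem_range_of_mem_schreierWord {G : Type} [Group G] {ι : Type} {rep : G → G}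
    {gen : ι → G} {t : G} (ht : t ∈ Set.range rep) {w : List (ι × Bool)} :
    ∀ l ∈ schreierWord rep gen t w, l.1.1 ∈ Set.range rep := by
  induction w generalizing t with
  | nil => simp [schreierWord]
  | cons a w ih =>
    obtain ⟨x, b⟩ := a
    intro l hl
    rcases List.mem_cons.1 hl with rfl | hl
    · cases b
      · exact ⟨_, rfl⟩
      · exact ht
    · exact ih ⟨_, rfl⟩ l hl

section Transversal

variable {G : Type} [Group G] {H : Subgroup G} {rep : G → G}

theorem rep_rep_mul (hrep1 : ∀ g : G, g * (rep g)⁻¹ ∈ H)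
    (hrep2 : ∀ g g' : G, g * g'⁻¹ ∈ H → rep g = rep g') (g a : G) :
    rep (rep g * a) = rep (g * a) :=
  (hrep2 _ _ (by simpa [mul_assoc] using hrep1 g)).symm

theorem finite_range_rep [H.FiniteIndex]
    (hrep2 : ∀ g g' : G, g * g'⁻¹ ∈ H → rep g = rep g') : (Set.range rep).Finite := by
  refine (Set.finite_range fun q : G ⧸ H => rep q.out⁻¹).subset ?_
  rintro _ ⟨g, rfl⟩
  refine ⟨((g⁻¹ : G) : G ⧸ H), hrep2 _ _ ?_⟩
  have h := QuotientGroup.eq.1 (QuotientGroup.out_eq' ((g⁻¹ : G) : G ⧸ H))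
  simpa using h

theorem prod_map_schreierEval_schreierWord {ι : Type} (gen : ι → G)
    (hrep1 : ∀ g : G, g * (rep g)⁻¹ ∈ H)
    (hrep2 : ∀ g g' : G, g * g'⁻¹ ∈ H → rep g = rep g') (w : List (ι × Bool)) {t : G}
    (ht : rep t = t) :
    ((schreierWord rep gen t w).map (schreierEval rep gen)).prod =
      t * evalWord gen w * (rep (t * evalWord gen w))⁻¹ := by
  have hmul := rep_rep_mul hrep1 hrep2
  have hidem (g : G) : rep (rep g) = rep g := by simpa using hmul g 1
  induction w generalizing t with
  | nil => simp [schreierWord, evalWord, ht]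
  | cons a w ih =>
    obtain ⟨x, b⟩ := a
    have hcons : evalWord gen ((x, b) :: w) =
        (if b then gen x else (gen x)⁻¹) * evalWord gen w := by simp [evalWord]
    rw [schreierWord, List.map_cons, List.prod_cons, ih (hidem _), hcons, hmul]
    cases b <;> simp [schreierEval, hmul, ht, mul_assoc]

end Transversal

/-- If `η` is a quasigeodesic normal form for `(G, Σ)` and `H` is a
finite index subgroup with right transversal `T = range rep` containing `1`, then the
Schreier normal form `ζ(h) = schreierWord rep gen (rep 1) (η h)` for `(H, Z)` is
quasigeodesic with respect to the Schreier generating set `Z`. -/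
theorem schreier_normal_form_quasigeodesic {G : Type} [Group G] {ι : Type} [Fintype ι]
    (gen : ι → G) (hgen : Subgroup.closure (Set.range gen) = ⊤)
    (H : Subgroup G) [H.FiniteIndex] (rep : G → G)
    (hrep1 : ∀ g : G, g * (rep g)⁻¹ ∈ H)
    (hrep2 : ∀ g g' : G, g * g'⁻¹ ∈ H → rep g = rep g')
    (hrepone : rep 1 = 1)
    (η : G → List (ι × Bool)) (hη : ∀ g, evalWord gen (η g) = g)
    (hqg : IsQuasigeodesicNF gen η) :
    ∃ lam : ℝ, 0 < lam ∧ ∀ h : H,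
      ((schreierWord rep gen (rep 1) (η (h : G))).length : ℝ) ≤
        lam * (schreierLength rep gen (h : G)) + lam := by
  obtain ⟨lam, hlam, hlen⟩ := hqg
  obtain ⟨M, hM⟩ : ∃ M, ∀ l : (G × ι) × Bool, l.1.1 ∈ Set.range rep →
      (η (schreierEval rep gen l)).length ≤ M := by
    have hfin : {l : (G × ι) × Bool | l.1.1 ∈ Set.range rep}.Finite :=
      (((finite_range_rep hrep2).prod Set.finite_univ).prod Set.finite_univ).subset
        fun l hl => ⟨⟨hl, trivial⟩, trivial⟩
    obtain ⟨M, hM⟩ := (hfin.image fun l => (η (schreierEval rep gen l)).length).bddAbove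
    exact ⟨M, fun l hl => hM ⟨l, hl, rfl⟩⟩
  refine ⟨lam * M + lam, by positivity, fun h => ?_⟩
  have hreph : rep (h : G) = 1 := by
    rw [← hrepone]
    exact hrep2 _ _ (by simp)
  obtain ⟨w, hw, hprod, hwlen⟩ : ∃ w : List ((G × ι) × Bool),
      (∀ l ∈ w, l.1.1 ∈ Set.range rep) ∧ (w.map (schreierEval rep gen)).prod = (h : G) ∧
        w.length = schreierLength rep gen (h : G) := by
    refine Nat.sInf_mem (s := {n | ∃ w : List ((G × ι) × Bool),
      (∀ l ∈ w, l.1.1 ∈ Set.range rep) ∧ (w.map (schreierEval rep gen)).prod = (h : G) ∧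
        w.length = n}) ⟨_, schreierWord rep gen (rep 1) (η (h : G)),
      mem_range_of_mem_schreierWord ⟨1, rfl⟩, ?_, rfl⟩
    rw [prod_map_schreierEval_schreierWord gen hrep1 hrep2 _ (by rw [hrepone, hrepone]), hη,
      hrepone, one_mul, hreph, inv_one, mul_one]
  have hle : (wordLength gen (h : G) : ℝ) ≤ M * schreierLength rep gen (h : G) := by
    rw [← hwlen]
    nth_rewrite 1 [← hprod]
    exact_mod_cast wordLength_prod_map_le gen _ η hη M w fun l hl => hM l (hw l hl)
  rw [length_schreierWord]
  calc ((η (h : G)).length : ℝ) ≤ lam * wordLength gen (h : G) + lam := hlen h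
    _ ≤ lam * (M * schreierLength rep gen (h : G)) + lam := by gcongr
    _ ≤ (lam * M + lam) * schreierLength rep gen (h : G) + (lam * M + lam) := by
      have h₁ : 0 ≤ lam * M := by positivity
      have h₂ : 0 ≤ lam * schreierLength rep gen (h : G) := by positivity
      linarith

end Paper
end
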